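/- If X is a locally hamiltonian vector field on ℝ^{(N+1)(n+1)} (so L_X ω = 0), then X is globally hamiltonian: there is an n-form f with i_X ω = df, and f can be taken of the form f = f^μ d^n x_μ + (1/2) f_i^{μν} dq^i ∧ d^n x_{μν} with f^μ = p_i^μ X^i + p X^μ + f_0^μ and f_i^{μν} = p_i^ν X^μ − p_i^μ X^ν, where f_0^μ are functions of (x,q) only. -/

import Mathlib

open scoped BigOperators

namespace MPS

variable (n N : ℕ)

/-- The multiphase space with base dimension `n+2` and `N` field components:
coordinates `(x^μ, q^i, p_i^μ, p)`. -/
abbrev Pt := (Fin (n+2) → ℝ) × (Fin N → ℝ) × (Fin N → Fin (n+2) → ℝ) × ℝ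

/-- A `k`-form on `Pt`, represented by its values on `k`-tuples of (constant) vectors. -/
abbrev Form (k : ℕ) := Pt n N → (Fin k → Pt n N) → ℝ

/-- The covector `dx^μ`. -/
def cx (μ : Fin (n+2)) : Pt n N → ℝ := fun z => z.1 μ
/-- The covector `dq^i`. -/
def cq (i : Fin N) : Pt n N → ℝ := fun z => z.2.1 i
/-- The covector `dp_i^μ`. -/
def cp (i : Fin N) (μ : Fin (n+2)) : Pt n N → ℝ := fun z => z.2.2.1 i μ
/-- The covector `dp` (energy). -/
def cE : Pt n N → ℝ := fun z => z.2.2.2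

/-- The coordinate vector `∂/∂x^μ`. -/
def ex (μ : Fin (n+2)) : Pt n N := (Pi.single μ 1, 0, 0, 0)
/-- The coordinate vector `∂/∂q^i`. -/
def eq (i : Fin N) : Pt n N := (0, Pi.single i 1, 0, 0)
/-- The coordinate vector `∂/∂p_i^μ`. -/
def ep (i : Fin N) (μ : Fin (n+2)) : Pt n N := (0, 0, Pi.single i (Pi.single μ 1), 0)
/-- The coordinate vector `∂/∂p`. -/
def eE : Pt n N := (0, 0, 0, 1)

/-- Wedge of a (constant-coefficient) 1-form with a `k`-form. -/
def wedge1 {k : ℕ} (α : Pt n N → ℝ) (β : (Fin k → Pt n N) → ℝ) :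
    (Fin (k+1) → Pt n N) → ℝ :=
  fun v => ∑ j : Fin (k+1), (-1 : ℝ) ^ (j : ℕ) * α (v j) * β (v ∘ j.succAbove)

/-- The volume covector `d^n x = dx^1 ∧ … ∧ dx^n`. -/
def vol : (Fin (n+2) → Pt n N) → ℝ :=
  fun v => Matrix.det (Matrix.of fun a b => (v b).1 a)

/-- `d^n x_μ = i_{∂_μ} d^n x`. -/
def volm (μ : Fin (n+2)) : (Fin (n+1) → Pt n N) → ℝ :=
  fun v => vol n N (Fin.cons (ex n N μ) v)

/-- The canonical multisymplectic form
`ω = dq^i ∧ dp_i^μ ∧ d^n x_μ − dp ∧ d^n x`. -/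
def omega : Form n N (n+3) :=
  fun _ v =>
    (∑ i : Fin N, ∑ μ : Fin (n+2),
      wedge1 n N (cq n N i) (wedge1 n N (cp n N i μ) (volm n N μ)) v)
    - wedge1 n N (cE n N) (vol n N) v

/-- The multicanonical form `θ = p_i^μ dq^i ∧ d^n x_μ + p d^n x`. -/
def theta : Form n N (n+2) :=
  fun z v =>
    (∑ i : Fin N, ∑ μ : Fin (n+2),
      z.2.2.1 i μ * wedge1 n N (cq n N i) (volm n N μ) v)
    + z.2.2.2 * vol n N v

/-- Exterior derivative of a `k`-form on the vector space `Pt`. -/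
noncomputable def extd {k : ℕ} (ω : Form n N k) : Form n N (k+1) :=
  fun x v => ∑ j : Fin (k+1), (-1 : ℝ) ^ (j : ℕ) *
    fderiv ℝ (fun y => ω y (v ∘ j.succAbove)) x (v j)

/-- Interior product of a vector field with a `(k+1)`-form. -/
def iVF {k : ℕ} (X : Pt n N → Pt n N) (ω : Form n N (k+1)) : Form n N k :=
  fun x v => ω x (Fin.cons (X x) v)

/-- Lie derivative of a `(k+1)`-form along a vector field (Cartan's formula). -/
noncomputable def lieD {k : ℕ} (X : Pt n N → Pt n N) (ω : Form n N (k+1)) : Form n N (k+1) :=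
  fun x v => extd n N (iVF n N X ω) x v + iVF n N X (extd n N ω) x v

/-- Lie bracket of vector fields on `Pt`. -/
noncomputable def lieB (X Y : Pt n N → Pt n N) : Pt n N → Pt n N :=
  fun z => fderiv ℝ Y z (X z) - fderiv ℝ X z (Y z)

/-- `d^n x_{μν} = i_{∂_ν} i_{∂_μ} d^n x`. -/
def volmn (μ ν : Fin (n+2)) : (Fin n → Pt n N) → ℝ :=
  fun v => vol n N (Fin.cons (ex n N μ) (Fin.cons (ex n N ν) v))

/-- Partial derivative `∂f/∂x^μ`. -/
noncomputable def pdx (f : Pt n N → ℝ) (z : Pt n N) (μ : Fin (n+2)) : ℝ :=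
  fderiv ℝ f z (ex n N μ)

/-- Partial derivative `∂f/∂q^i`. -/
noncomputable def pdq (f : Pt n N → ℝ) (z : Pt n N) (i : Fin N) : ℝ :=
  fderiv ℝ f z (eq n N i)

/-- Partial derivative `∂f/∂p_i^μ`. -/
noncomputable def pdp (f : Pt n N → ℝ) (z : Pt n N) (i : Fin N) (μ : Fin (n+2)) : ℝ :=
  fderiv ℝ f z (ep n N i μ)

/-- Partial derivative `∂f/∂p`. -/
noncomputable def pdE (f : Pt n N → ℝ) (z : Pt n N) : ℝ :=
  fderiv ℝ f z (eE n N)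

end MPS

namespace MPS

section Analysis
variable {E : Type*} [NormedAddCommGroup E] [NormedSpace ℝ E] [FiniteDimensional ℝ E]

theorem pint_hasFDerivAt (F : E × ℝ → ℝ) (hF : ContDiff ℝ 1 F) (x : E) :
    HasFDerivAt (fun x => ∫ t in (0:ℝ)..1, F (x, t))
      (∫ t in (0:ℝ)..1, (fderiv ℝ F (x, t)).comp (ContinuousLinearMap.inl ℝ E ℝ)) x := by
  have hc : Continuous (fun s : E × ℝ => (fderiv ℝ F s).comp (ContinuousLinearMap.inl ℝ E ℝ)) :=
    (hF.continuous_fderiv (by simp)).clm_comp continuous_const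
  obtain ⟨C, hC⟩ := ((isCompact_closedBall x 1).prod
    (isCompact_Icc (a := (0:ℝ)) (b := 1))).exists_bound_of_continuousOn hc.continuousOn
  have hFc := hF.continuous
  refine intervalIntegral.hasFDerivAt_integral_of_dominated_of_fderiv_le
    (F := fun x t => F (x, t))
    (F' := fun x t => (fderiv ℝ F (x, t)).comp (ContinuousLinearMap.inl ℝ E ℝ))
    (bound := fun _ => C) (Metric.ball_mem_nhds x one_pos) ?_ ?_ ?_ ?_ ?_ ?_
  · refine Filter.Eventually.of_forall fun y => ?_
    exact (show Continuous (fun t => F (y, t)) by fun_prop).aestronglyMeasurable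
  · exact (show Continuous (fun t => F (x, t)) by fun_prop).intervalIntegrable _ _
  · exact (hc.comp (Continuous.prodMk_right x)).aestronglyMeasurable
  · refine Filter.Eventually.of_forall fun t ht y hy => ?_
    refine hC (y, t) ⟨Metric.ball_subset_closedBall hy, ?_⟩
    rw [Set.uIoc_of_le zero_le_one] at ht
    exact ⟨ht.1.le, ht.2⟩
  · exact intervalIntegrable_const
  · refine Filter.Eventually.of_forall fun t ht y hy => ?_
    have h1 : HasFDerivAt F (fderiv ℝ F (y, t)) (y, t) :=
      (hF.differentiable (by simp) (y, t)).hasFDerivAt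
    exact h1.comp y (hasFDerivAt_prodMk_left y t)

theorem pint_fderiv (F : E × ℝ → ℝ) (hF : ContDiff ℝ 1 F) (x a : E) :
    fderiv ℝ (fun x => ∫ t in (0:ℝ)..1, F (x, t)) x a =
      ∫ t in (0:ℝ)..1, fderiv ℝ F (x, t) (a, 0) := by
  have hc : Continuous (fun s : E × ℝ => (fderiv ℝ F s).comp (ContinuousLinearMap.inl ℝ E ℝ)) :=
    (hF.continuous_fderiv (by simp)).clm_comp continuous_const
  rw [(pint_hasFDerivAt F hF x).fderiv, ContinuousLinearMap.intervalIntegral_apply]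
  · simp
  · exact (hc.comp (Continuous.prodMk_right x)).intervalIntegrable _ _

theorem pint_contDiff_nat (m : ℕ) : ∀ (F : E × ℝ → ℝ), ContDiff ℝ (⊤ : ℕ∞) F →
    ContDiff ℝ m (fun x => ∫ t in (0:ℝ)..1, F (x, t)) := by
  induction m with
  | zero =>
    intro F hF
    have h1 : ContDiff ℝ 1 F := hF.of_le (by exact_mod_cast le_top)
    exact contDiff_zero.2 (continuous_iff_continuousAt.2 fun x =>
      (pint_hasFDerivAt F h1 x).continuousAt)
  | succ m ih =>
    intro F hF
    have h1 : ContDiff ℝ 1 F := hF.of_le (by exact_mod_cast le_top)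
    push_cast
    rw [contDiff_succ_iff_fderiv_apply]
    refine ⟨fun x => (pint_hasFDerivAt F h1 x).differentiableAt, by simp, fun a => ?_⟩
    simp_rw [pint_fderiv F h1]
    refine ih (fun s => fderiv ℝ F s (a, 0)) ?_
    exact (hF.fderiv_right (m := ((⊤ : ℕ∞) : WithTop ℕ∞)) (by simp)).clm_apply contDiff_const

theorem pint_contDiff (F : E × ℝ → ℝ) (hF : ContDiff ℝ (⊤ : ℕ∞) F) :
    ContDiff ℝ (⊤ : ℕ∞) (fun x => ∫ t in (0:ℝ)..1, F (x, t)) :=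
  contDiff_infty.2 fun m => pint_contDiff_nat m F hF

theorem pint_fderiv' (F : E × ℝ → ℝ) (hF : ContDiff ℝ (⊤ : ℕ∞) F) (x a : E) :
    fderiv ℝ (fun x => ∫ t in (0:ℝ)..1, F (x, t)) x a =
      ∫ t in (0:ℝ)..1, fderiv ℝ (fun y => F (y, t)) x a := by
  have h1 : ContDiff ℝ 1 F := hF.of_le (by exact_mod_cast le_top)
  rw [pint_fderiv F h1]
  congr 1
  ext t
  have h2 : HasFDerivAt F (fderiv ℝ F (x, t)) (x, t) :=
      (h1.differentiable (by simp) (x, t)).hasFDerivAt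
  have h3 : HasFDerivAt (fun y => F (y, t)) _ x :=
    HasFDerivAt.comp x h2 (hasFDerivAt_prodMk_left x t)
  rw [h3.fderiv]
  simp

end Analysis
end MPS

namespace MPS
section Potential
variable (n N : ℕ)

/-- `(x,q,p,e) ↦ (x, t q, 0, 0)`. -/
noncomputable def Lt (t : ℝ) : Pt n N →L[ℝ] Pt n N :=
  (ContinuousLinearMap.fst ℝ _ _).prod
    ((t • (ContinuousLinearMap.fst ℝ _ _).comp (ContinuousLinearMap.snd ℝ _ _)).prod 0)

theorem Lt_apply (t : ℝ) (z : Pt n N) : Lt n N t z = (z.1, t • z.2.1, 0, 0) := rfl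

/-- `(x,q,p,e) ↦ (x - (1-t) x^0 e_0, 0, 0, 0)`. -/
noncomputable def Mt (t : ℝ) : Pt n N →L[ℝ] Pt n N :=
  ContinuousLinearMap.prod ((ContinuousLinearMap.fst ℝ _ _) -
    (1 - t) • ((ContinuousLinearMap.proj (R := ℝ) (φ := fun _ : Fin (n+2) => ℝ) 0).comp
      (ContinuousLinearMap.fst ℝ _ _)).smulRight (Pi.single 0 1)) 0

theorem Mt_apply (t : ℝ) (z : Pt n N) :
    Mt n N t z = (z.1 - ((1 - t) * z.1 0) • Pi.single 0 1, 0, 0, 0) := by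
  simp [Mt, mul_smul]; rfl

theorem exists_potential (g : Fin N → Fin (n+2) → Pt n N → ℝ) (h : Pt n N → ℝ)
    (hg : ∀ i μ, ContDiff ℝ (⊤ : ℕ∞) (g i μ)) (hh : ContDiff ℝ (⊤ : ℕ∞) h)
    (h1 : ∀ z i j μ, fderiv ℝ (g i μ) z (eq n N j) = fderiv ℝ (g j μ) z (eq n N i))
    (h2 : ∀ z i, ∑ μ, fderiv ℝ (g i μ) z (ex n N μ) = fderiv ℝ h z (eq n N i)) :
    ∃ f0 : Pt n N → Fin (n+2) → ℝ, ContDiff ℝ (⊤ : ℕ∞) f0 ∧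
      (∀ z w : Pt n N, z.1 = w.1 → z.2.1 = w.2.1 → f0 z = f0 w) ∧
      (∀ z i μ, fderiv ℝ (fun y => f0 y μ) z (eq n N i) = - g i μ (Lt n N 1 z)) ∧
      (∀ z, ∑ μ, fderiv ℝ (fun y => f0 y μ) z (ex n N μ) = - h (Lt n N 1 z)) := by
  set F1 : Fin (n+2) → Pt n N × ℝ → ℝ := fun μ s =>
    ∑ i, s.1.2.1 i * g i μ (Lt n N s.2 s.1) with hF1
  set F2 : Pt n N × ℝ → ℝ := fun s => s.1.1 0 * h (Mt n N s.2 s.1) with hF2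
  have sF1 : ∀ μ, ContDiff ℝ (⊤ : ℕ∞) (F1 μ) := by
    intro μ
    simp only [hF1, Lt_apply]
    refine ContDiff.sum fun i _ => ContDiff.mul (by fun_prop) ((hg i μ).comp (by fun_prop))
  have sF2 : ContDiff ℝ (⊤ : ℕ∞) F2 := by
    simp only [hF2, Mt_apply]
    exact ContDiff.mul (by fun_prop) (hh.comp (by fun_prop))
  have dg : ∀ i μ z, HasFDerivAt (g i μ) (fderiv ℝ (g i μ) z) z := fun i μ z =>
    ((hg i μ).differentiable (by simp) z).hasFDerivAt
  have dh : ∀ z, HasFDerivAt h (fderiv ℝ h z) z := fun z =>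
    (hh.differentiable (by simp) z).hasFDerivAt
  have cg : ∀ i μ, Continuous (g i μ) := fun i μ => (hg i μ).continuous
  have ch : Continuous h := hh.continuous
  have cLt : ∀ z, Continuous (fun t => Lt n N t z) := by
    intro z; simp only [Lt_apply]; fun_prop
  have cMt : ∀ z, Continuous (fun t => Mt n N t z) := by
    intro z; simp only [Mt_apply]; fun_prop
  have cdg : ∀ i μ (a z : Pt n N), Continuous (fun t => fderiv ℝ (g i μ) (Lt n N t z) a) := by
    intro i μ a z
    exact (((hg i μ).continuous_fderiv (by simp)).comp (cLt z)).clm_apply continuous_const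
  have cdh : ∀ (a z : Pt n N), Continuous (fun t => fderiv ℝ h (Lt n N t z) a) := by
    intro a z
    exact ((hh.continuous_fderiv (by simp)).comp (cLt z)).clm_apply continuous_const
  have cdh' : ∀ (a z : Pt n N), Continuous (fun t => fderiv ℝ h (Mt n N t z) a) := by
    intro a z
    exact ((hh.continuous_fderiv (by simp)).comp (cMt z)).clm_apply continuous_const
  -- derivatives of the integrands
  have dF1 : ∀ μ z t a, fderiv ℝ (fun y => F1 μ (y, t)) z a =
      ∑ i, (z.2.1 i * fderiv ℝ (g i μ) (Lt n N t z) (Lt n N t a) +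
        g i μ (Lt n N t z) * a.2.1 i) := by
    intro μ z t a
    have hq : ∀ i, HasFDerivAt (fun y : Pt n N => y.2.1 i)
        ((ContinuousLinearMap.proj (R := ℝ) (φ := fun _ : Fin N => ℝ) i).comp
          ((ContinuousLinearMap.fst ℝ _ _).comp (ContinuousLinearMap.snd ℝ _ _))) z := fun i =>
      ContinuousLinearMap.hasFDerivAt (x := z)
        ((ContinuousLinearMap.proj (R := ℝ) (φ := fun _ : Fin N => ℝ) i).comp
          ((ContinuousLinearMap.fst ℝ (Fin N → ℝ) ((Fin N → Fin (n+2) → ℝ) × ℝ)).comp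
            (ContinuousLinearMap.snd ℝ (Fin (n+2) → ℝ) _)))
    have hs : HasFDerivAt (fun y => F1 μ (y, t)) _ z :=
      HasFDerivAt.fun_sum (u := Finset.univ) fun i _ =>
        (hq i).mul ((dg i μ (Lt n N t z)).comp z (Lt n N t).hasFDerivAt)
    rw [hs.fderiv]
    simp
  have dF2 : ∀ z t a, fderiv ℝ (fun y => F2 (y, t)) z a =
      z.1 0 * fderiv ℝ h (Mt n N t z) (Mt n N t a) + h (Mt n N t z) * a.1 0 := by
    intro z t a
    have hq : HasFDerivAt (fun y : Pt n N => y.1 0)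
        ((ContinuousLinearMap.proj (R := ℝ) (φ := fun _ : Fin (n+2) => ℝ) 0).comp
          (ContinuousLinearMap.fst ℝ _ _)) z :=
      ContinuousLinearMap.hasFDerivAt (x := z)
        ((ContinuousLinearMap.proj (R := ℝ) (φ := fun _ : Fin (n+2) => ℝ) 0).comp
          (ContinuousLinearMap.fst ℝ (Fin (n+2) → ℝ) ((Fin N → ℝ) × (Fin N → Fin (n+2) → ℝ) × ℝ)))
    have hs : HasFDerivAt (fun y => F2 (y, t)) _ z :=
        hq.mul ((dh (Mt n N t z)).comp z (Mt n N t).hasFDerivAt)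
    rw [hs.fderiv]
    simp
  have eqsum : ∀ z : Pt n N, ((0, z.2.1, 0, 0) : Pt n N) = ∑ i, z.2.1 i • eq n N i := by
    intro z
    have hz : z.2.1 = ∑ i, z.2.1 i • (Pi.single i 1 : Fin N → ℝ) := by
      ext j; simp [Pi.single_apply]
    refine Prod.ext ?_ (Prod.ext ?_ (Prod.ext ?_ ?_))
    · simp [Prod.fst_sum, Prod.snd_sum, eq]
    · simpa [Prod.fst_sum, Prod.snd_sum, eq] using hz
    · simp [Prod.fst_sum, Prod.snd_sum, eq]
    · simp [Prod.fst_sum, Prod.snd_sum, eq]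
  have dLt : ∀ z t, HasDerivAt (fun t => Lt n N t z) (0, z.2.1, 0, 0) t := by
    intro z t
    simp only [Lt_apply]
    refine (hasDerivAt_const t z.1).prodMk (HasDerivAt.prodMk ?_ (hasDerivAt_const t _))
    simpa using (hasDerivAt_id t).smul_const z.2.1
  have dMt : ∀ z t, HasDerivAt (fun t => Mt n N t z) (z.1 0 • ex n N 0) t := by
    intro z t
    have : (z.1 0 • ex n N 0 : Pt n N) = (z.1 0 • Pi.single 0 1, 0) := by simp [ex]
    simp only [Mt_apply]
    rw [this]
    refine HasDerivAt.prodMk ?_ (hasDerivAt_const t _)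
    have h3 : HasDerivAt (fun t : ℝ => (1 - t) * z.1 0) (- z.1 0) t := by
      simpa using ((hasDerivAt_id t).const_sub 1).mul_const (z.1 0)
    simpa using (h3.smul_const (Pi.single 0 1 : Fin (n+2) → ℝ)).const_sub z.1
  have I1 : ∀ z i μ, ∫ t in (0:ℝ)..1, fderiv ℝ (fun y => F1 μ (y, t)) z (eq n N i) =
      g i μ (Lt n N 1 z) := by
    intro z j μ
    have hd : ∀ t ∈ Set.uIcc (0:ℝ) 1, HasDerivAt (fun t => t * g j μ (Lt n N t z))
        (fderiv ℝ (fun y => F1 μ (y, t)) z (eq n N j)) t := by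
      intro t _
      have h3 := (hasDerivAt_id t).mul ((dg j μ (Lt n N t z)).comp_hasDerivAt t (dLt z t))
      refine h3.congr_deriv ?_
      have hL : Lt n N t (eq n N j) = t • eq n N j := by
        simp [Lt_apply, eq]
      rw [dF1, hL, eqsum z, map_sum]
      simp only [map_smul, smul_eq_mul, Finset.sum_add_distrib, h1 _ _ j]
      simp [eq, Pi.single_apply, Finset.mul_sum]
      rw [add_comm]
      congr 1
      refine Finset.sum_congr rfl fun i _ => ?_
      ring
    rw [intervalIntegral.integral_eq_sub_of_hasDerivAt hd]
    · simp
    · refine Continuous.intervalIntegrable ?_ _ _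
      have hL : ∀ t, Lt n N t (eq n N j) = t • eq n N j := by
        intro t; simp [Lt_apply, eq]
      simp only [dF1, hL, map_smul]
      refine continuous_finsetSum _ fun i _ => ?_
      exact (continuous_const.mul (continuous_id.smul (cdg i μ _ z))).add
        (((cg i μ).comp (cLt z)).mul continuous_const)
  have I2 : ∀ z, ∑ μ, ∫ t in (0:ℝ)..1, fderiv ℝ (fun y => F1 μ (y, t)) z (ex n N μ) =
      h (Lt n N 1 z) - h (Lt n N 0 z) := by
    intro z
    have hL : ∀ t μ, Lt n N t (ex n N μ) = ex n N μ := by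
      intro t μ; simp [Lt_apply, ex]
    have hex : ∀ μ i, (ex n N μ : Pt n N).2.1 i = 0 := by intro μ i; simp [ex]
    rw [← intervalIntegral.integral_finsetSum]
    · have hd : ∀ t ∈ Set.uIcc (0:ℝ) 1, HasDerivAt (fun t => h (Lt n N t z))
          (∑ μ, fderiv ℝ (fun y => F1 μ (y, t)) z (ex n N μ)) t := by
        intro t _
        have h3 := (dh (Lt n N t z)).comp_hasDerivAt t (dLt z t)
        refine h3.congr_deriv ?_
        simp only [dF1, hL, hex]
        rw [Finset.sum_comm, eqsum z, map_sum]
        simp only [map_smul, smul_eq_mul, mul_zero, add_zero, ← Finset.mul_sum, h2]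
      rw [intervalIntegral.integral_eq_sub_of_hasDerivAt hd]
      refine Continuous.intervalIntegrable ?_ _ _
      simp only [dF1, hL, hex]
      refine continuous_finsetSum _ fun μ _ => continuous_finsetSum _ fun i _ => ?_
      exact (continuous_const.mul (cdg i μ _ z)).add
        (((cg i μ).comp (cLt z)).mul continuous_const)
    · intro μ _
      refine Continuous.intervalIntegrable ?_ _ _
      simp only [dF1, hL, hex]
      refine continuous_finsetSum _ fun i _ => ?_
      exact (continuous_const.mul (cdg i μ _ z)).add
        (((cg i μ).comp (cLt z)).mul continuous_const)
  have I3 : ∀ z, ∫ t in (0:ℝ)..1, fderiv ℝ (fun y => F2 (y, t)) z (ex n N 0) =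
      h (Lt n N 0 z) := by
    intro z
    have hL : ∀ t, Mt n N t (ex n N 0) = t • ex n N 0 := by
      intro t; simp only [Mt_apply, ex]
      refine Prod.ext ?_ (by simp)
      simp; rw [sub_smul]; simp
    have hd : ∀ t ∈ Set.uIcc (0:ℝ) 1, HasDerivAt (fun t => t * h (Mt n N t z))
        (fderiv ℝ (fun y => F2 (y, t)) z (ex n N 0)) t := by
      intro t _
      have h3 := (hasDerivAt_id t).mul ((dh (Mt n N t z)).comp_hasDerivAt t (dMt z t))
      refine h3.congr_deriv ?_
      have hx0 : (ex n N 0 : Pt n N).1 0 = 1 := by simp [ex]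
      rw [dF2, hL, hx0, map_smul, map_smul]
      simp
      ring
    rw [intervalIntegral.integral_eq_sub_of_hasDerivAt hd]
    · simp [Mt_apply, Lt_apply]
    · refine Continuous.intervalIntegrable ?_ _ _
      simp only [dF2, hL, map_smul]
      exact (continuous_const.mul (continuous_id.smul (cdh' _ z))).add
        ((ch.comp (cMt z)).mul continuous_const)
  have I4 : ∀ z i, fderiv ℝ (fun y => ∫ t in (0:ℝ)..1, F2 (y, t)) z (eq n N i) = 0 := by
    intro z i
    rw [pint_fderiv' F2 sF2]
    have : ∀ t, fderiv ℝ (fun y => F2 (y, t)) z (eq n N i) = 0 := by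
      intro t
      rw [dF2]
      simp [Mt_apply, eq]
      right
      exact map_zero _
    simp [this]
  have sI1 := fun μ => pint_contDiff (F1 μ) (sF1 μ)
  have sI2 := pint_contDiff F2 sF2
  have df : ∀ μ z a, fderiv ℝ (fun y => -(∫ t in (0:ℝ)..1, F1 μ (y, t)) -
      (if μ = 0 then 1 else 0) * ∫ t in (0:ℝ)..1, F2 (y, t)) z a =
      -fderiv ℝ (fun y => (∫ t in (0:ℝ)..1, F1 μ (y, t))) z a -
      (if μ = 0 then 1 else 0) * fderiv ℝ (fun y => ∫ t in (0:ℝ)..1, F2 (y, t)) z a := by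
    intro μ z a
    have e1 := ((sI1 μ).differentiable (by simp) z).hasFDerivAt
    have e2 := (sI2.differentiable (by simp) z).hasFDerivAt
    have e3 : HasFDerivAt
      (fun y => -(∫ t in (0:ℝ)..1, F1 μ (y, t)) -
      (if μ = 0 then 1 else 0) * ∫ t in (0:ℝ)..1, F2 (y, t)) _ z :=
      e1.neg.sub (e2.const_mul (if μ = 0 then (1:ℝ) else 0))
    rw [e3.fderiv]
    split_ifs <;> simp
  refine ⟨fun z μ => -(∫ t in (0:ℝ)..1, F1 μ (z, t)) -
    (if μ = 0 then 1 else 0) * ∫ t in (0:ℝ)..1, F2 (z, t), ?_, ?_, ?_, ?_⟩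
  · rw [contDiff_pi]
    intro μ
    exact (sI1 μ).neg.sub (contDiff_const.mul sI2)
  · intro z w h1 h2
    simp only [hF1, hF2, Lt_apply, Mt_apply, h1, h2]
  · intro z i μ
    rw [df, pint_fderiv' _ (sF1 μ), I1, I4]
    simp
  · intro z
    simp only [df, Finset.sum_sub_distrib, Finset.sum_neg_distrib]
    simp only [fun μ => pint_fderiv' _ (sF1 μ), I2]
    simp [pint_fderiv' _ sF2, I3]

end Potential
end MPS

namespace MPS
section Algebra
variable (n N : ℕ)

/-- Alternating sum `∑ (-1)^j Φ (v_j) (v without v_j)`. -/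
def asum {P : Type*} {k : ℕ} (Φ : P → (Fin k → P) → ℝ) (v : Fin (k+1) → P) : ℝ :=
  ∑ j : Fin (k+1), (-1 : ℝ) ^ (j : ℕ) * Φ (v j) (v ∘ j.succAbove)

section asum
variable {P : Type*} {k : ℕ}

theorem cons_comp_zero (a : P) (v : Fin k → P) :
    (Fin.cons a v : Fin (k+1) → P) ∘ (0 : Fin (k+1)).succAbove = v := by
  ext j; simp

theorem cons_comp_succ (a : P) (v : Fin (k+1) → P) (j : Fin (k+1)) :
    (Fin.cons a v : Fin (k+2) → P) ∘ (j.succ).succAbove = Fin.cons a (v ∘ j.succAbove) := by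
  ext i
  refine Fin.cases ?_ (fun i => ?_) i <;> simp

theorem asum_cons (Φ : P → (Fin (k+1) → P) → ℝ) (a : P) (v : Fin (k+1) → P) :
    asum Φ (Fin.cons a v) = Φ a v - asum (fun b u => Φ b (Fin.cons a u)) v := by
  unfold asum
  rw [Fin.sum_univ_succ, sub_eq_add_neg, ← Finset.sum_neg_distrib]
  congr 1
  · simp only [cons_comp_zero]; simp
  · refine Finset.sum_congr rfl fun j _ => ?_
    rw [cons_comp_succ]
    simp [pow_succ]

theorem asum_add (Φ Ψ : P → (Fin k → P) → ℝ) (v : Fin (k+1) → P) :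
    asum (fun a u => Φ a u + Ψ a u) v = asum Φ v + asum Ψ v := by
  simp [asum, mul_add, Finset.sum_add_distrib]

theorem asum_neg (Φ : P → (Fin k → P) → ℝ) (v : Fin (k+1) → P) :
    asum (fun a u => - Φ a u) v = - asum Φ v := by
  simp [asum]

theorem asum_mul (c : ℝ) (Φ : P → (Fin k → P) → ℝ) (v : Fin (k+1) → P) :
    asum (fun a u => c * Φ a u) v = c * asum Φ v := by
  simp only [asum, Finset.mul_sum]
  exact Finset.sum_congr rfl fun j _ => by ring

theorem asum_sum {ι : Type*} (s : Finset ι) (Φ : ι → P → (Fin k → P) → ℝ) (v : Fin (k+1) → P) :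
    asum (fun a u => ∑ i ∈ s, Φ i a u) v = ∑ i ∈ s, asum (Φ i) v := by
  simp only [asum, Finset.mul_sum]
  exact Finset.sum_comm

theorem asum_zero (Φ : P → (Fin k → P) → ℝ) (v : Fin (k+1) → P)
    (h : ∀ j, Φ (v j) (v ∘ j.succAbove) = 0) : asum Φ v = 0 := by
  simp [asum, h]

theorem asum_congr (Φ Ψ : P → (Fin k → P) → ℝ) (v : Fin (k+1) → P)
    (h : ∀ j, Φ (v j) (v ∘ j.succAbove) = Ψ (v j) (v ∘ j.succAbove)) : asum Φ v = asum Ψ v := by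
  simp [asum, h]

end asum

theorem wedge1_eq {k : ℕ} (α : Pt n N → ℝ) (β : (Fin k → Pt n N) → ℝ) (v : Fin (k+1) → Pt n N) :
    wedge1 n N α β v = asum (fun a u => α a * β u) v := by
  simp [wedge1, asum, mul_assoc]

theorem extd_eq {k : ℕ} (ω : Form n N k) (x : Pt n N) (v : Fin (k+1) → Pt n N) :
    extd n N ω x v = asum (fun a u => fderiv ℝ (fun y => ω y u) x a) v := rfl

theorem wedge1_cons {k : ℕ} (α : Pt n N → ℝ) (β : (Fin (k+1) → Pt n N) → ℝ) (a : Pt n N)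
    (v : Fin (k+1) → Pt n N) :
    wedge1 n N α β (Fin.cons a v) =
      α a * β v - wedge1 n N α (fun u => β (Fin.cons a u)) v := by
  simp only [wedge1_eq, asum_cons]

theorem wedge1_cons_of_zero {k : ℕ} (α : Pt n N → ℝ) (β : (Fin k → Pt n N) → ℝ) (a : Pt n N)
    (v : Fin k → Pt n N) (hv : ∀ j, α (v j) = 0) :
    wedge1 n N α β (Fin.cons a v) = α a * β v := by
  unfold wedge1
  rw [Fin.sum_univ_succ]
  have h := congrArg β (cons_comp_zero a v)
  simp only [Fin.cons_zero, Fin.cons_succ, hv, h]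
  simp

theorem wedge1_of_zero {k : ℕ} (α : Pt n N → ℝ) (β : (Fin k → Pt n N) → ℝ)
    (v : Fin (k+1) → Pt n N) (hv : ∀ j, α (v j) = 0) :
    wedge1 n N α β v = 0 := by
  simp [wedge1, hv]

theorem wedge1_anti {k : ℕ} : ∀ (α β : Pt n N → ℝ) (γ : (Fin k → Pt n N) → ℝ)
    (v : Fin (k+2) → Pt n N),
    wedge1 n N α (wedge1 n N β γ) v = - wedge1 n N β (wedge1 n N α γ) v := by
  induction k with
  | zero =>
    intro α β γ v
    have : ∀ x y : Fin 0 → Pt n N, γ x = γ y := fun x y => congrArg γ (Subsingleton.elim _ _)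
    simp [wedge1, Fin.sum_univ_succ]
    rw [this _ ![]]
    rw [this ((v ∘ Fin.succAbove 1) ∘ Fin.succ) ![]]
    ring
  | succ k ih =>
    intro α β γ v
    obtain ⟨a, v, rfl⟩ : ∃ a u, v = Fin.cons a u := ⟨v 0, Fin.tail v, (Fin.cons_self_tail v).symm⟩
    have key : ∀ α β : Pt n N → ℝ, wedge1 n N α (wedge1 n N β γ) (Fin.cons a v) =
        α a * wedge1 n N β γ v - β a * wedge1 n N α γ v +
          wedge1 n N α (wedge1 n N β (fun u => γ (Fin.cons a u))) v := by
      intro α β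
      rw [wedge1_cons]
      simp only [wedge1_cons n N β]
      have : wedge1 n N α (fun u => β a * γ u - wedge1 n N β (fun u => γ (Fin.cons a u)) u) v =
          β a * wedge1 n N α γ v - wedge1 n N α (wedge1 n N β (fun u => γ (Fin.cons a u))) v := by
        rw [wedge1_eq, wedge1_eq, wedge1_eq, ← asum_mul, sub_eq_add_neg, ← asum_neg, ← asum_add]
        refine asum_congr _ _ _ fun j => ?_
        ring
      rw [this]; ring
    rw [key, key, ih]
    ring

/-- `vol` through the alternating determinant. -/
theorem vol_eq (v : Fin (n+2) → Pt n N) :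
    vol n N v = (Matrix.detRowAlternating (R := ℝ) (n := Fin (n+2))) (fun b => (v b).1) := by
  rw [vol, ← Matrix.det_transpose]; rfl

theorem cons_fst {k : ℕ} (a : Pt n N) (u : Fin k → Pt n N) :
    (fun b => ((Fin.cons a u : Fin (k+1) → Pt n N) b).1) =
      Fin.cons a.1 (fun b => (u b).1) := by
  ext b c
  refine Fin.cases ?_ (fun i => ?_) b <;> simp

theorem vol_cons (a : Pt n N) (u : Fin (n+1) → Pt n N) :
    vol n N (Fin.cons a u) = ∑ μ, a.1 μ * volm n N μ u := by
  have h : ∀ b : Pt n N, vol n N (Fin.cons b u) =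
      (Matrix.detRowAlternating (R := ℝ) (n := Fin (n+2))).toMultilinearMap.curryLeft b.1
        (fun b => (u b).1) := by
    intro b
    rw [vol_eq, cons_fst]; rfl
  have ha : a.1 = ∑ μ, a.1 μ • (Pi.single μ 1 : Fin (n+2) → ℝ) := by
    ext j; simp [Pi.single_apply]
  simp only [volm, h]
  conv_lhs => rw [ha]
  simp [ex]

theorem vol_zero (v : Fin (n+2) → Pt n N) (m : Fin (n+2)) (h : (v m).1 = 0) : vol n N v = 0 := by
  rw [vol_eq]
  exact (Matrix.detRowAlternating (R := ℝ) (n := Fin (n+2))).map_coord_zero m h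

theorem vol_eq_zero_of_eq (v : Fin (n+2) → Pt n N) (i j : Fin (n+2)) (hij : i ≠ j)
    (h : (v i).1 = (v j).1) : vol n N v = 0 := by
  rw [vol_eq]
  exact (Matrix.detRowAlternating (R := ℝ) (n := Fin (n+2))).map_eq_zero_of_eq _ h hij

theorem vol_swap (a b : Pt n N) (u : Fin n → Pt n N) :
    vol n N (Fin.cons a (Fin.cons b u)) = - vol n N (Fin.cons b (Fin.cons a u)) := by
  rw [vol_eq, vol_eq, ← AlternatingMap.map_swap (i := 0) (j := 1) _ _ (by simp)]
  congr 1
  ext m c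
  refine Fin.cases ?_ (fun m => Fin.cases ?_ (fun m => ?_) m) m
  · simp
  · change b.1 c = ((Fin.cons b (Fin.cons a u) : Fin (n+2) → Pt n N) (Equiv.swap 0 1 1)).1 c
    rw [Equiv.swap_apply_right]; rfl
  · have h1 : m.succ.succ ≠ (0 : Fin (n+2)) := Fin.succ_ne_zero _
    have h2 : m.succ.succ ≠ (1 : Fin (n+2)) := by
      intro h
      exact Fin.succ_ne_zero m (Fin.succ_injective _ (h.trans Fin.succ_zero_eq_one.symm))
    simp [Equiv.swap_apply_of_ne_of_ne h1 h2]

theorem volm_cons (μ : Fin (n+2)) (a : Pt n N) (u : Fin n → Pt n N) :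
    volm n N μ (Fin.cons a u) = ∑ ν, a.1 ν * volmn n N μ ν u := by
  rw [volm, vol_swap, vol_cons, ← Finset.sum_neg_distrib]
  refine Finset.sum_congr rfl fun ν _ => ?_
  rw [volm, vol_swap, volmn]; ring

theorem volmn_anti (μ ν : Fin (n+2)) (u : Fin n → Pt n N) :
    volmn n N μ ν u = - volmn n N ν μ u := vol_swap n N _ _ _

theorem volm_zero (μ : Fin (n+2)) (v : Fin (n+1) → Pt n N) (m : Fin (n+1)) (h : (v m).1 = 0) :
    volm n N μ v = 0 := vol_zero n N _ m.succ (by simpa using h)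

theorem volm_eq (μ : Fin (n+2)) (v : Fin (n+1) → Pt n N) :
    volm n N μ v = (-1) ^ (μ : ℕ) *
      Matrix.det (Matrix.of fun (a b : Fin (n+1)) => (v b).1 (μ.succAbove a)) := by
  rw [volm, vol, Matrix.det_succ_column_zero]
  rw [Finset.sum_eq_single μ]
  · simp [ex]
    rfl
  · intro i _ hi
    simp [ex, hi]
  · simp

theorem cx_volm (ν μ : Fin (n+2)) (v : Fin (n+2) → Pt n N) :
    wedge1 n N (cx n N ν) (volm n N μ) v = if ν = μ then vol n N v else 0 := by
  have h := congrFun (congrFun (Matrix.mul_adjugate (Matrix.of fun a b => (v b).1 a)) ν) μ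
  rw [Matrix.mul_apply] at h
  simp only [Matrix.adjugate_fin_succ_eq_det_submatrix, Matrix.smul_apply, Matrix.one_apply] at h
  simp only [wedge1, volm_eq]
  rw [show (if ν = μ then vol n N v else 0) = vol n N v * (if ν = μ then 1 else 0) by simp]
  refine Eq.trans ?_ h
  refine Finset.sum_congr rfl fun j _ => ?_
  simp only [cx, pow_add, Matrix.of_apply]
  have : (Matrix.of fun a b => (v b).1 a).submatrix μ.succAbove j.succAbove =
    Matrix.of fun (a b : Fin (n+1)) => ((v ∘ j.succAbove) b).1 (μ.succAbove a) := rfl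
  rw [this]; ring

theorem nondeg (c : Fin (n+2) → ℝ)
    (h : ∀ u : Fin (n+1) → Pt n N, (∀ j, ∃ κ, u j = ex n N κ) → ∑ μ, c μ * volm n N μ u = 0)
    (μ : Fin (n+2)) : c μ = 0 := by
  have h1 := h (fun j => ex n N (μ.succAbove j)) (fun j => ⟨_, rfl⟩)
  rw [Finset.sum_eq_single μ] at h1
  · have h2 : volm n N μ (fun j => ex n N (μ.succAbove j)) ≠ 0 := by
      rw [volm_eq]
      have : (Matrix.of fun (a b : Fin (n+1)) => (ex n N (μ.succAbove b)).1 (μ.succAbove a)) = 1 := by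
        ext a b
        simp [ex, Pi.single_apply, Matrix.one_apply]
      rw [this]; simp
    exact (mul_eq_zero.1 h1).resolve_right h2
  · intro κ _ hκ
    obtain ⟨j, hj⟩ := Fin.exists_succAbove_eq hκ
    have : volm n N κ (fun j => ex n N (μ.succAbove j)) = 0 := by
      refine vol_eq_zero_of_eq n N _ 0 j.succ (Fin.succ_ne_zero j).symm ?_
      simp [hj]
    rw [this, mul_zero]
  · simp

/-! ### The canonical form -/

/-- Vertical vectors. -/
def isV (w : Pt n N) : Prop := w.1 = 0 ∧ w.2.1 = 0

theorem theta_add (a b : Pt n N) (v : Fin (n+2) → Pt n N) :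
    theta n N (a + b) v = theta n N a v + theta n N b v := by
  simp only [theta, Prod.snd_add, Prod.fst_add, Pi.add_apply, add_mul, Finset.sum_add_distrib]
  ring

theorem theta_smul (c : ℝ) (b : Pt n N) (v : Fin (n+2) → Pt n N) :
    theta n N (c • b) v = c * theta n N b v := by
  simp only [theta, Prod.smul_snd, Prod.smul_fst, Pi.smul_apply, smul_eq_mul, mul_add,
    Finset.mul_sum, mul_assoc]

theorem theta_vert (z : Pt n N) (v : Fin (n+2) → Pt n N) (m : Fin (n+2)) (h : isV n N (v m)) :
    theta n N z v = 0 := by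
  have h1 : ∀ i μ, wedge1 n N (cq n N i) (volm n N μ) v = 0 := by
    intro i μ
    unfold wedge1
    refine Finset.sum_eq_zero fun j _ => ?_
    by_cases hj : m = j
    · subst hj
      simp [cq, h.2]
    · obtain ⟨l, hl⟩ := Fin.exists_succAbove_eq hj
      rw [volm_zero n N μ _ l (by simp [hl, h.1]), mul_zero]
  simp [theta, h1, vol_zero n N v m h.1]

theorem theta_base (z : Pt n N) (h : z.2.2 = 0) (v : Fin (n+2) → Pt n N) : theta n N z v = 0 := by
  simp [theta, h]

theorem theta_cons (z a : Pt n N) (u : Fin (n+1) → Pt n N) :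
    theta n N z (Fin.cons a u) =
      (∑ μ : Fin (n+2), ((∑ i : Fin N, z.2.2.1 i μ * a.2.1 i) + z.2.2.2 * a.1 μ) * volm n N μ u)
      + (1/2 : ℝ) * ∑ i : Fin N, ∑ μ : Fin (n+2), ∑ ν : Fin (n+2),
          (z.2.2.1 i ν * a.1 μ - z.2.2.1 i μ * a.1 ν) * wedge1 n N (cq n N i) (volmn n N μ ν) u := by
  have hW : ∀ i μ ν, wedge1 n N (cq n N i) (volmn n N μ ν) u =
      - wedge1 n N (cq n N i) (volmn n N ν μ) u := by
    intro i μ ν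
    rw [wedge1_eq, wedge1_eq, ← asum_neg]
    refine asum_congr _ _ _ fun j => ?_
    rw [volmn_anti]; ring
  have h1 : ∀ i μ, wedge1 n N (cq n N i) (volm n N μ) (Fin.cons a u) =
      a.2.1 i * volm n N μ u - ∑ ν, a.1 ν * wedge1 n N (cq n N i) (volmn n N μ ν) u := by
    intro i μ
    rw [wedge1_cons]
    simp only [volm_cons, wedge1_eq, ← asum_mul, ← asum_sum]
    congr 1
    refine asum_congr _ _ _ fun j => ?_
    simp only [Finset.mul_sum]
    exact Finset.sum_congr rfl fun j _ => by ring
  have h2 : ∀ i, (1/2 : ℝ) * ∑ μ : Fin (n+2), ∑ ν : Fin (n+2),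
      (z.2.2.1 i ν * a.1 μ - z.2.2.1 i μ * a.1 ν) * wedge1 n N (cq n N i) (volmn n N μ ν) u =
      - ∑ μ : Fin (n+2), ∑ ν : Fin (n+2),
        z.2.2.1 i μ * (a.1 ν * wedge1 n N (cq n N i) (volmn n N μ ν) u) := by
    intro i
    simp only [sub_mul, Finset.sum_sub_distrib]
    rw [Finset.sum_comm]
    have : ∑ y : Fin (n+2), ∑ x : Fin (n+2),
        z.2.2.1 i y * a.1 x * wedge1 n N (cq n N i) (volmn n N x y) u =
        - ∑ y : Fin (n+2), ∑ x : Fin (n+2),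
        z.2.2.1 i y * a.1 x * wedge1 n N (cq n N i) (volmn n N y x) u := by
      simp only [← Finset.sum_neg_distrib]
      refine Finset.sum_congr rfl fun y _ => Finset.sum_congr rfl fun x _ => ?_
      rw [hW]; ring
    rw [this]
    simp only [mul_assoc]
    ring
  rw [Finset.mul_sum]
  simp only [h2]
  rw [theta, vol_cons]
  simp only [h1, mul_sub, Finset.mul_sum, Finset.sum_sub_distrib, add_mul, Finset.sum_add_distrib,
    Finset.sum_mul, Finset.sum_neg_distrib]
  rw [Finset.sum_comm]
  simp only [mul_assoc]
  ring

theorem theta_slot_add (z a b : Pt n N) (u : Fin (n+1) → Pt n N) :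
    theta n N z (Fin.cons (a + b) u) = theta n N z (Fin.cons a u) + theta n N z (Fin.cons b u) := by
  simp only [theta_cons, Prod.snd_add, Prod.fst_add, Pi.add_apply]
  simp only [mul_add, add_mul, sub_mul, Finset.sum_add_distrib, Finset.sum_sub_distrib]
  ring

theorem theta_slot_smul (z : Pt n N) (c : ℝ) (b : Pt n N) (u : Fin (n+1) → Pt n N) :
    theta n N z (Fin.cons (c • b) u) = c * theta n N z (Fin.cons b u) := by
  simp only [theta_cons, Prod.smul_snd, Prod.smul_fst, Pi.smul_apply, smul_eq_mul, mul_add,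
    Finset.mul_sum, Finset.sum_mul, add_mul]
  congr 1
  · refine Finset.sum_congr rfl fun _ _ => ?_
    congr 1
    · exact Finset.sum_congr rfl fun _ _ => by ring
    · ring
  · exact Finset.sum_congr rfl fun _ _ => Finset.sum_congr rfl fun _ _ =>
      Finset.sum_congr rfl fun _ _ => by ring

theorem omega_eq (z : Pt n N) (v : Fin (n+3) → Pt n N) :
    omega n N z v = - asum (theta n N) v := by
  have : asum (theta n N) v = asum (fun a u => (∑ i : Fin N, ∑ μ : Fin (n+2),
      cp n N i μ a * wedge1 n N (cq n N i) (volm n N μ) u) + cE n N a * vol n N u) v := rfl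
  rw [this, asum_add, asum_sum]
  simp only [asum_sum]
  rw [omega, neg_add, wedge1_eq n N (cE n N), ← Finset.sum_neg_distrib, sub_eq_add_neg]
  congr 1
  refine Finset.sum_congr rfl fun i _ => ?_
  rw [← Finset.sum_neg_distrib]
  refine Finset.sum_congr rfl fun μ _ => ?_
  rw [wedge1_anti, wedge1_eq n N (cp n N i μ)]

theorem omega_cons (z a : Pt n N) (v : Fin (n+2) → Pt n N) :
    omega n N z (Fin.cons a v) =
      - theta n N a v + asum (fun b u => theta n N b (Fin.cons a u)) v := by
  rw [omega_eq, asum_cons]; ring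

theorem omega_vert (z w : Pt n N) (hw : isV n N w) (v : Fin (n+2) → Pt n N) :
    omega n N z (Fin.cons w v) = - theta n N w v := by
  rw [omega_cons, asum_zero, add_zero]
  intro j
  exact theta_vert n N _ _ 0 (by simpa using hw)

theorem omega_vert2 (z a w : Pt n N) (hw : isV n N w) (u : Fin (n+1) → Pt n N) :
    omega n N z (Fin.cons a (Fin.cons w u)) = theta n N w (Fin.cons a u) := by
  rw [omega_cons, asum_cons, theta_vert n N a _ 0 (by simpa using hw), asum_zero]
  · ring
  · intro j
    exact theta_vert n N _ _ 1 hw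

theorem omega_base (z a : Pt n N) (v : Fin (n+2) → Pt n N) (hv : ∀ j, (v j).2.2 = 0) :
    omega n N z (Fin.cons a v) = - theta n N a v := by
  rw [omega_cons, asum_zero, add_zero]
  intro j
  exact theta_base n N _ (hv j) _

end Algebra
end MPS

namespace MPS
section Vertical
variable (n N : ℕ)

theorem isV_ep (i : Fin N) (μ : Fin (n+2)) : isV n N (ep n N i μ) := ⟨rfl, rfl⟩

theorem theta_q (w a : Pt n N) (i : Fin N) (u : Fin n → Pt n N) (hu : ∀ j, (u j).2.1 = 0) :
    theta n N w (Fin.cons a (Fin.cons (eq n N i) u)) =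
      ∑ μ, w.2.2.1 i μ * vol n N (Fin.cons a (Fin.cons (ex n N μ) u)) := by
  have h1 : ∀ k μ, wedge1 n N (cq n N k) (volm n N μ) (Fin.cons a (Fin.cons (eq n N i) u)) =
      if k = i then vol n N (Fin.cons a (Fin.cons (ex n N μ) u)) else 0 := by
    intro k μ
    rw [wedge1_cons, volm_zero n N μ _ 0 (by simp [eq]),
      wedge1_cons_of_zero _ _ _ _ _ _ (by intro j; simp [cq, hu j]), volm, vol_swap]
    by_cases h : k = i <;> simp [cq, eq, h]
  have h2 : vol n N (Fin.cons a (Fin.cons (eq n N i) u)) = 0 := vol_zero n N _ 1 rfl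
  rw [theta, h2]
  simp only [h1]
  simp

theorem theta_ep (a : Pt n N) (i : Fin N) (ν : Fin (n+2)) (u : Fin n → Pt n N)
    (hu : ∀ j, (u j).2.1 = 0) :
    theta n N (ep n N i ν) (Fin.cons a (Fin.cons (eq n N i) u)) =
      ∑ μ, a.1 μ * volm n N μ (Fin.cons (ex n N ν) u) := by
  rw [theta_q n N _ _ _ _ hu, ← vol_cons]
  simp [ep, Pi.single_apply]

theorem theta_vcons (z a : Pt n N) (h : a.1 = 0) (u : Fin (n+1) → Pt n N) :
    theta n N z (Fin.cons a u) = ∑ μ, (∑ i, z.2.2.1 i μ * a.2.1 i) * volm n N μ u := by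
  rw [theta_cons]; simp [h]

theorem star (A : Pt n N →L[ℝ] Pt n N)
    (H : ∀ v : Fin (n+3) → Pt n N, asum (fun a u => omega n N 0 (Fin.cons (A a) u)) v = 0)
    (w : Pt n N) (hw : isV n N w) (v : Fin (n+2) → Pt n N) :
    omega n N 0 (Fin.cons (A w) v) = asum (fun b u => theta n N w (Fin.cons (A b) u)) v := by
  have h := H (Fin.cons w v)
  rw [asum_cons] at h
  simp only [fun b => omega_vert2 n N 0 (A b) w hw] at h
  linarith

theorem sym (A : Pt n N →L[ℝ] Pt n N)
    (H : ∀ v : Fin (n+3) → Pt n N, asum (fun a u => omega n N 0 (Fin.cons (A a) u)) v = 0)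
    (w1 w2 : Pt n N) (h1 : isV n N w1) (h2 : isV n N w2) (u : Fin (n+1) → Pt n N) :
    theta n N w2 (Fin.cons (A w1) u) = theta n N w1 (Fin.cons (A w2) u) := by
  have h := star n N A H w1 h1 (Fin.cons w2 u)
  rw [omega_vert2 n N 0 _ _ h2, asum_cons] at h
  rw [h, asum_zero _ u, sub_zero]
  intro j
  exact theta_vert n N _ _ 1 h2

theorem B_zero (A : Pt n N →L[ℝ] Pt n N)
    (H : ∀ v : Fin (n+3) → Pt n N, asum (fun a u => omega n N 0 (Fin.cons (A a) u)) v = 0)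
    (w : Pt n N) (hw : isV n N w) (i : Fin N) (hi : w.2.2.1 i = 0) :
    (A w).1 = 0 := by
  funext μ
  refine nondeg n N (fun μ => (A w).1 μ) (fun u hu => ?_) μ
  obtain ⟨ν, hν⟩ := hu 0
  have hq : ∀ j, (Fin.tail u j).2.1 = 0 := by
    intro j
    obtain ⟨κ, hκ⟩ := hu j.succ
    simp [Fin.tail, hκ, ex]
  have h := sym n N A H w (ep n N i ν) hw (isV_ep n N i ν) (Fin.cons (eq n N i) (Fin.tail u))
  rw [theta_ep n N _ _ _ _ hq, theta_q n N _ _ _ _ hq, hi, ← hν, Fin.cons_self_tail] at h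
  rw [h]; simp

theorem vert_preserved (A : Pt n N →L[ℝ] Pt n N)
    (H : ∀ v : Fin (n+3) → Pt n N, asum (fun a u => omega n N 0 (Fin.cons (A a) u)) v = 0)
    (hN : 1 < N) (w : Pt n N) (hw : isV n N w) : isV n N (A w) := by
  have hB : ∀ w : Pt n N, isV n N w → (A w).1 = 0 := by
    intro w hw
    set i0 : Fin N := ⟨0, by omega⟩
    set i1 : Fin N := ⟨1, hN⟩
    have h01 : i1 ≠ i0 := by simp [i0, i1]
    set w' : Pt n N := (0, 0, Pi.single i0 (w.2.2.1 i0), 0) with hw'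
    have e : w = w' + (w - w') := by abel
    have v' : isV n N w' := ⟨rfl, rfl⟩
    have a1 := B_zero n N A H w' v' i1 (by simp [hw', h01])
    have a2 := B_zero n N A H (w - w') ⟨by simp [hw.1, v'.1], by simp [hw.2, v'.2]⟩ i0
      (by simp [hw'])
    rw [e, map_add, Prod.fst_add, a1, a2, add_zero]
  have hC : ∀ w : Pt n N, isV n N w → ∀ μ, (∀ i, w.2.2.1 i μ = 0) → (A w).2.1 = 0 := by
    intro w hw μ hμ
    funext k
    have h : ∀ μ', (∑ i, (ep n N k μ).2.2.1 i μ' * (A w).2.1 i) -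
        (∑ i, w.2.2.1 i μ' * (A (ep n N k μ)).2.1 i) = 0 := by
      intro μ'
      refine nondeg n N (fun μ' => (∑ i, (ep n N k μ).2.2.1 i μ' * (A w).2.1 i) -
        (∑ i, w.2.2.1 i μ' * (A (ep n N k μ)).2.1 i)) (fun u hu => ?_) μ'
      have h := sym n N A H w (ep n N k μ) hw (isV_ep n N k μ) u
      rw [theta_vcons n N _ _ (hB _ hw), theta_vcons n N _ _ (hB _ (isV_ep n N k μ))] at h
      simp only [sub_mul, Finset.sum_sub_distrib]
      rw [h, sub_self]
    have h3 := h μ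
    simp only [hμ, zero_mul, Finset.sum_const_zero, sub_zero] at h3
    rw [Finset.sum_eq_single k] at h3
    · simpa [ep] using h3
    · intro b _ hb
      simp [ep, hb]
    · simp
  refine ⟨hB w hw, ?_⟩
  set w' : Pt n N := (0, 0, fun i => Pi.single 0 (w.2.2.1 i 0), 0) with hw'
  have e : w = w' + (w - w') := by abel
  have v' : isV n N w' := ⟨rfl, rfl⟩
  have a1 := hC w' v' 1 (by simp [hw'])
  have a2 := hC (w - w') ⟨by simp [hw.1, v'.1], by simp [hw.2, v'.2]⟩ 0 (by simp [hw'])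
  rw [e, map_add, Prod.snd_add, Prod.fst_add, a1, a2, add_zero]

end Vertical

section Main
variable (n N : ℕ)

/-- `theta` as a linear form in the point. -/
noncomputable def thetaL (v : Fin (n+2) → Pt n N) : Pt n N →L[ℝ] ℝ :=
  LinearMap.toContinuousLinearMap
    { toFun := fun a => theta n N a v
      map_add' := fun a b => theta_add n N a b v
      map_smul' := fun c a => theta_smul n N c a v }

theorem thetaL_apply (v : Fin (n+2) → Pt n N) (a : Pt n N) : thetaL n N v a = theta n N a v := rfl

/-- `theta` as a linear form in the first slot. -/
noncomputable def thetaS (z : Pt n N) (u : Fin (n+1) → Pt n N) : Pt n N →L[ℝ] ℝ :=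
  LinearMap.toContinuousLinearMap
    { toFun := fun a => theta n N z (Fin.cons a u)
      map_add' := fun a b => theta_slot_add n N z a b u
      map_smul' := fun c a => theta_slot_smul n N z c a u }

/-- `theta` as a bilinear form in the point and the first slot. -/
noncomputable def thetaB (u : Fin (n+1) → Pt n N) : Pt n N →L[ℝ] Pt n N →L[ℝ] ℝ :=
  LinearMap.toContinuousLinearMap
    { toFun := fun z => thetaS n N z u
      map_add' := fun a b => ContinuousLinearMap.ext fun x => theta_add n N a b _
      map_smul' := fun c a => ContinuousLinearMap.ext fun x => theta_smul n N c a _ }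

/-- `omega` as a linear form in the first slot. -/
noncomputable def omegaL (v : Fin (n+2) → Pt n N) : Pt n N →L[ℝ] ℝ :=
  LinearMap.toContinuousLinearMap
    { toFun := fun a => omega n N 0 (Fin.cons a v)
      map_add' := fun a b => by
        simp only [omega_cons, theta_add, theta_slot_add, asum_add]; ring
      map_smul' := fun c a => by
        simp only [omega_cons, theta_smul, theta_slot_smul, asum_mul, RingHom.id_apply,
          smul_eq_mul]; ring }

theorem fderiv_omega (X : Pt n N → Pt n N) (z : Pt n N) (hX : DifferentiableAt ℝ X z)
    (v : Fin (n+2) → Pt n N) (a : Pt n N) :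
    fderiv ℝ (fun y => omega n N y (Fin.cons (X y) v)) z a =
      omega n N 0 (Fin.cons (fderiv ℝ X z a) v) := by
  have h : HasFDerivAt (fun y => omega n N y (Fin.cons (X y) v))
    ((omegaL n N v).comp (fderiv ℝ X z)) z := (omegaL n N v).hasFDerivAt.comp z hX.hasFDerivAt
  rw [h.fderiv]; rfl

theorem fderiv_theta (X : Pt n N → Pt n N) (z : Pt n N) (hX : DifferentiableAt ℝ X z)
    (u : Fin (n+1) → Pt n N) :
    ∃ D : Pt n N →L[ℝ] ℝ, HasFDerivAt (fun y => theta n N y (Fin.cons (X y) u)) D z ∧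
      ∀ a, D a = theta n N a (Fin.cons (X z) u) + theta n N z (Fin.cons (fderiv ℝ X z a) u) := by
  have h := (thetaB n N u).hasFDerivAt_of_bilinear (hasFDerivAt_id z) hX.hasFDerivAt
  refine ⟨_, h, fun a => ?_⟩
  refine Eq.trans ?_ (add_comm (theta n N z (Fin.cons (fderiv ℝ X z a) u)) _)
  rfl

theorem lie_H (X : Pt n N → Pt n N) (hX : Differentiable ℝ X)
    (hH : ∀ (z : Pt n N) (v : Fin (n+3) → Pt n N), lieD n N X (omega n N) z v = 0)
    (z : Pt n N) (v : Fin (n+3) → Pt n N) :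
    asum (fun a u => omega n N 0 (Fin.cons (fderiv ℝ X z a) u)) v = 0 := by
  have h := hH z v
  rw [lieD, extd_eq] at h
  simp only [iVF] at h
  simp only [fderiv_omega n N X z (hX z)] at h
  rw [← h, left_eq_add, extd_eq]
  refine asum_zero _ _ fun j => ?_
  have : (fun y => omega n N y ((Fin.cons (X z) v : Fin (n+4) → Pt n N) ∘ j.succAbove)) =
    fun _ => omega n N 0 ((Fin.cons (X z) v : Fin (n+4) → Pt n N) ∘ j.succAbove) := rfl
  rw [this]
  simp

theorem const_along {F : Type*} [NormedAddCommGroup F] [NormedSpace ℝ F] (φ : Pt n N → F)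
    (hφ : Differentiable ℝ φ) (w : Pt n N) (h : ∀ y, fderiv ℝ φ y w = 0) (z : Pt n N) :
    φ (z + w) = φ z := by
  have hd : ∀ t : ℝ, HasDerivAt (fun t : ℝ => φ (z + t • w)) 0 t := by
    intro t
    have h1 : HasDerivAt (fun t : ℝ => z + t • w) w t := by
      simpa using ((hasDerivAt_id t).smul_const w).const_add z
    have := (hφ (z + t • w)).hasFDerivAt.comp_hasDerivAt t h1
    rwa [h] at this
  have := is_const_of_deriv_eq_zero (fun t => (hd t).differentiableAt) (fun t => (hd t).deriv) 1 0
  simpa using this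

theorem isV_iff (w : Pt n N) : isV n N w ↔ Lt n N 1 w = 0 := by
  simp [isV, Lt_apply, Prod.ext_iff]

theorem isV_sub (z : Pt n N) : isV n N (z - Lt n N 1 z) := by
  simp [isV, Lt_apply]

theorem theta_slot_base (z a : Pt n N) (u : Fin (n+1) → Pt n N) :
    theta n N z (Fin.cons a u) = theta n N z (Fin.cons (Lt n N 1 a) u) := by
  conv_lhs => rw [show a = Lt n N 1 a + (a - Lt n N 1 a) by abel]
  rw [theta_slot_add, theta_vert n N z (Fin.cons (a - Lt n N 1 a) u) 0 (isV_sub n N a), add_zero]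

theorem vol_ex : vol n N (ex n N) = 1 := by
  rw [vol]
  have : (Matrix.of fun a b => (ex n N b).1 a) = 1 := by
    ext a b
    simp [ex, Pi.single_apply, Matrix.one_apply]
  rw [this, Matrix.det_one]

theorem base_inv (X : Pt n N → Pt n N) (hX : ContDiff ℝ (⊤ : ℕ∞) X)
    (H : ∀ z (v : Fin (n+3) → Pt n N),
      asum (fun a u => omega n N 0 (Fin.cons (fderiv ℝ X z a) u)) v = 0)
    (hN : 1 < N) (w : Pt n N) (hw : isV n N w) (z a : Pt n N) :
    Lt n N 1 (fderiv ℝ X (z + w) a) = Lt n N 1 (fderiv ℝ X z a) := by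
  have hd : Differentiable ℝ X := hX.differentiable (by simp)
  have hφ : ∀ z, HasFDerivAt (fun y => Lt n N 1 (X y)) ((Lt n N 1).comp (fderiv ℝ X z)) z :=
    fun z => (Lt n N 1).hasFDerivAt.comp z (hd z).hasFDerivAt
  have h1 : ∀ y, fderiv ℝ (fun y => Lt n N 1 (X y)) y w = 0 := by
    intro y
    rw [(hφ y).fderiv]
    exact (isV_iff n N _).1 (vert_preserved n N _ (H y) hN w hw)
  have h2 : (fun y => Lt n N 1 (X (y + w))) = fun y => Lt n N 1 (X y) := by
    funext y
    exact const_along n N (fun y => Lt n N 1 (X y)) (fun z => (hφ z).differentiableAt) w h1 y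
  have h3 := fderiv_comp_add_right (𝕜 := ℝ) (f := fun y => Lt n N 1 (X y)) (x := z) w
  rw [h2, (hφ z).fderiv, (hφ (z + w)).fderiv] at h3
  exact (congrArg (fun D => D a) h3).symm

theorem star' (X : Pt n N → Pt n N)
    (H : ∀ z (v : Fin (n+3) → Pt n N),
      asum (fun a u => omega n N 0 (Fin.cons (fderiv ℝ X z a) u)) v = 0)
    (hN : 1 < N) (w : Pt n N) (hw : isV n N w) (z : Pt n N) (v : Fin (n+2) → Pt n N) :
    theta n N (fderiv ℝ X z w) v =
      - asum (fun b u => theta n N w (Fin.cons (fderiv ℝ X z b) u)) v := by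
  rw [← star n N _ (H z) w hw, omega_vert n N 0 _ (vert_preserved n N _ (H z) hN w hw), neg_neg]

theorem affine (X : Pt n N → Pt n N) (hX : ContDiff ℝ (⊤ : ℕ∞) X)
    (H : ∀ z (v : Fin (n+3) → Pt n N),
      asum (fun a u => omega n N 0 (Fin.cons (fderiv ℝ X z a) u)) v = 0)
    (hN : 1 < N) (z : Pt n N) (v : Fin (n+2) → Pt n N) :
    theta n N (X z) v = theta n N (X (Lt n N 1 z)) v +
      theta n N (fderiv ℝ X z (z - Lt n N 1 z)) v := by
  have hd : Differentiable ℝ X := hX.differentiable (by simp)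
  set z0 := Lt n N 1 z
  set w := z - z0 with hwdef
  have hw : isV n N w := isV_sub n N z
  have hc : ∀ t : ℝ, theta n N (fderiv ℝ X (z0 + t • w) w) v = theta n N (fderiv ℝ X z w) v := by
    intro t
    rw [star' n N X H hN w hw, star' n N X H hN w hw, neg_inj]
    refine asum_congr _ _ _ fun j => ?_
    rw [theta_slot_base, theta_slot_base n N w (fderiv ℝ X z _)]
    have hz : z = (z0 + t • w) + (1 - t) • w := by
      rw [add_assoc, ← add_smul, hwdef]; simp
    have hw' : isV n N ((1 - t) • w) := by
      rw [isV_iff] at hw ⊢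
      rw [map_smul, hw, smul_zero]
    conv_rhs => rw [hz]
    rw [base_inv n N X hX H hN _ hw']
  have hder : ∀ t : ℝ, HasDerivAt (fun t : ℝ => theta n N (X (z0 + t • w)) v -
      t * theta n N (fderiv ℝ X z w) v) 0 t := by
    intro t
    have h1 : HasDerivAt (fun t : ℝ => z0 + t • w) w t := by
      simpa using ((hasDerivAt_id t).smul_const w).const_add z0
    have h2 := (hd (z0 + t • w)).hasFDerivAt.comp_hasDerivAt t h1
    have h3 := (thetaL n N v).hasFDerivAt.comp_hasDerivAt t h2
    have h4 := h3.sub ((hasDerivAt_id t).mul_const (theta n N (fderiv ℝ X z w) v))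
    rw [thetaL_apply, hc, one_mul, sub_self] at h4
    exact h4
  have := is_const_of_deriv_eq_zero (fun t => (hder t).differentiableAt)
    (fun t => (hder t).deriv) 1 0
  have hz : z0 + w = z := by rw [hwdef]; abel
  simp only [one_smul, hz, zero_smul, add_zero, zero_mul, one_mul, sub_zero] at this
  linarith

theorem closed_base (X : Pt n N → Pt n N)
    (H : ∀ z (v : Fin (n+3) → Pt n N),
      asum (fun a u => omega n N 0 (Fin.cons (fderiv ℝ X z a) u)) v = 0)
    (z : Pt n N) (v : Fin (n+3) → Pt n N) (hv : ∀ j, (v j).2.2 = 0) :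
    asum (fun a u => theta n N (fderiv ℝ X z a) u) v = 0 := by
  have h := H z v
  rw [← neg_eq_zero, ← asum_neg, ← h]
  refine asum_congr _ _ _ fun j => ?_
  exact (omega_base n N 0 _ (v ∘ j.succAbove) (fun l => hv _)).symm

theorem theta_eq_cons (c : Pt n N) (i : Fin N) (u : Fin (n+1) → Pt n N) :
    theta n N c (Fin.cons (eq n N i) u) = ∑ μ, c.2.2.1 i μ * volm n N μ u := by
  rw [theta_vcons n N _ _ rfl]
  simp [eq, Pi.single_apply]

theorem closed1 (X : Pt n N → Pt n N)
    (H : ∀ z (v : Fin (n+3) → Pt n N),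
      asum (fun a u => omega n N 0 (Fin.cons (fderiv ℝ X z a) u)) v = 0)
    (z : Pt n N) (i j : Fin N) (μ : Fin (n+2)) :
    (fderiv ℝ X z (eq n N j)).2.2.1 i μ = (fderiv ℝ X z (eq n N i)).2.2.1 j μ := by
  rw [← sub_eq_zero]
  refine nondeg n N (fun μ => (fderiv ℝ X z (eq n N j)).2.2.1 i μ -
    (fderiv ℝ X z (eq n N i)).2.2.1 j μ) (fun u hu => ?_) μ
  have h := closed_base n N X H z (Fin.cons (eq n N j) (Fin.cons (eq n N i) u)) (by
    intro l
    refine Fin.cases rfl (fun l => Fin.cases rfl (fun l => ?_) l) l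
    obtain ⟨κ, hκ⟩ := hu l
    simp [hκ, ex])
  rw [asum_cons, asum_cons, asum_zero _ u, theta_eq_cons, theta_eq_cons] at h
  · simp only [sub_mul, Finset.sum_sub_distrib]
    linarith
  · intro l
    rw [theta_eq_cons]
    refine Finset.sum_eq_zero fun μ _ => ?_
    rw [volm_zero n N μ _ 0 rfl, mul_zero]

theorem closed2 (X : Pt n N → Pt n N)
    (H : ∀ z (v : Fin (n+3) → Pt n N),
      asum (fun a u => omega n N 0 (Fin.cons (fderiv ℝ X z a) u)) v = 0)
    (z : Pt n N) (i : Fin N) :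
    ∑ μ, (fderiv ℝ X z (ex n N μ)).2.2.1 i μ = (fderiv ℝ X z (eq n N i)).2.2.2 := by
  have h := closed_base n N X H z (Fin.cons (eq n N i) (ex n N)) (by
    intro l
    refine Fin.cases rfl (fun l => rfl) l)
  have h1 : ∀ c, theta n N c (ex n N) = c.2.2.2 := by
    intro c
    rw [theta, vol_ex]
    simp only [fun k μ => wedge1_of_zero n N (cq n N k) (volm n N μ) (ex n N) (fun j => rfl)]
    simp
  rw [asum_cons, h1] at h
  simp only [theta_eq_cons, asum_sum] at h
  have h2 : ∀ μ, asum (fun a u => (fderiv ℝ X z a).2.2.1 i μ * volm n N μ u) (ex n N) =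
      (fderiv ℝ X z (ex n N μ)).2.2.1 i μ := by
    intro μ
    have : asum (fun a u => (fderiv ℝ X z a).2.2.1 i μ * volm n N μ u) (ex n N) =
      asum (fun a u => ∑ ν, (fderiv ℝ X z (ex n N ν)).2.2.1 i μ * (cx n N ν a * volm n N μ u))
        (ex n N) := by
      refine asum_congr _ _ _ fun j => ?_
      simp [cx, ex, Pi.single_apply]
    rw [this, asum_sum]
    simp only [asum_mul, ← wedge1_eq, cx_volm, vol_ex]
    simp
  simp only [h2] at h
  linarith

theorem lin_decomp (D : Pt n N →L[ℝ] ℝ) (hD : ∀ w, isV n N w → D w = 0) (a : Pt n N) :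
    D a = ∑ i, D (eq n N i) * cq n N i a + ∑ ν, D (ex n N ν) * cx n N ν a := by
  have h0 : D a = D (Lt n N 1 a) := by
    conv_lhs => rw [show a = Lt n N 1 a + (a - Lt n N 1 a) by abel]
    rw [map_add, hD _ (isV_sub n N a), add_zero]
  have h1 : Lt n N 1 a = ∑ i, a.2.1 i • eq n N i + ∑ ν, a.1 ν • ex n N ν := by
    refine Prod.ext ?_ (Prod.ext ?_ (Prod.ext ?_ ?_))
    · ext j; simp [Lt_apply, Prod.fst_sum, eq, ex, Pi.single_apply]
    · ext j; simp [Lt_apply, Prod.fst_sum, Prod.snd_sum, eq, ex, Pi.single_apply]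
    · simp [Lt_apply, Prod.fst_sum, Prod.snd_sum, eq, ex]
    · simp [Lt_apply, Prod.snd_sum, eq, ex]
  rw [h0, h1, map_add, map_sum, map_sum]
  simp [cq, cx, mul_comm]

theorem final_alg (D : Fin (n+2) → Pt n N →L[ℝ] ℝ) (hD : ∀ μ w, isV n N w → D μ w = 0) (c : Pt n N)
    (h1 : ∀ μ i, D μ (eq n N i) = - c.2.2.1 i μ) (h2 : ∑ μ, D μ (ex n N μ) = - c.2.2.2)
    (v : Fin (n+2) → Pt n N) :
    asum (fun a u => ∑ μ, D μ a * volm n N μ u) v = - theta n N c v := by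
  have h3 : ∀ μ, asum (fun a u => D μ a * volm n N μ u) v =
      - (∑ i, c.2.2.1 i μ * wedge1 n N (cq n N i) (volm n N μ) v) + D μ (ex n N μ) * vol n N v := by
    intro μ
    have : asum (fun a u => D μ a * volm n N μ u) v =
      asum (fun a u => ∑ i, (D μ (eq n N i)) * (cq n N i a * volm n N μ u) +
        ∑ ν, D μ (ex n N ν) * (cx n N ν a * volm n N μ u)) v := by
      refine asum_congr _ _ _ fun j => ?_
      rw [lin_decomp n N (D μ) (hD μ)]
      simp only [add_mul, Finset.sum_mul, mul_assoc]
    rw [this, asum_add, asum_sum, asum_sum]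
    simp only [asum_mul, ← wedge1_eq, cx_volm, h1]
    simp
  rw [asum_sum]
  simp only [h3, Finset.sum_add_distrib, ← Finset.sum_mul, h2, Finset.sum_neg_distrib]
  rw [theta, Finset.sum_comm]
  ring

end Main
end MPS

open MPS in
/-- every locally hamiltonian vector field is globally hamiltonian:
`i_X ω = df` with `f = f^μ d^n x_μ + (1/2) f_i^{μν} dq^i ∧ d^n x_{μν}`, where
`f^μ = p_i^μ X^i + p X^μ + f_0^μ` and `f_i^{μν} = p_i^ν X^μ − p_i^μ X^ν`,
the `f_0^μ` being functions of `(x,q)` only. -/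
theorem locHam_globallyHam (n N : ℕ) (hN : 1 < N)
    (X : Pt n N → Pt n N) (hX : ContDiff ℝ (⊤ : ℕ∞) X)
    (hH : ∀ (z : Pt n N) (v : Fin (n+3) → Pt n N), lieD n N X (omega n N) z v = 0) :
    ∃ f0 : Pt n N → Fin (n+2) → ℝ, ContDiff ℝ (⊤ : ℕ∞) f0 ∧
      (∀ z w : Pt n N, z.1 = w.1 → z.2.1 = w.2.1 → f0 z = f0 w) ∧
      (∀ (z : Pt n N) (v : Fin (n+2) → Pt n N),
        iVF n N X (omega n N) z v =
          extd n N (fun y u =>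
            (∑ μ : Fin (n+2),
              ((∑ i : Fin N, y.2.2.1 i μ * (X y).2.1 i) + y.2.2.2 * (X y).1 μ + f0 y μ)
                * volm n N μ u)
            + (1/2 : ℝ) * ∑ i : Fin N, ∑ μ : Fin (n+2), ∑ ν : Fin (n+2),
                (y.2.2.1 i ν * (X y).1 μ - y.2.2.1 i μ * (X y).1 ν)
                  * wedge1 n N (cq n N i) (volmn n N μ ν) u) z v) := by
  have hd : Differentiable ℝ X := hX.differentiable (by simp)
  have H := lie_H n N X hd hH
  have hX' := fun z => (hd z).hasFDerivAt
  have dg : ∀ i μ z a, fderiv ℝ (fun y => (X y).2.2.1 i μ) z a = (fderiv ℝ X z a).2.2.1 i μ := by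
    intro i μ z a
    have h := hasFDerivAt_pi'.1 (hasFDerivAt_pi'.1 (hX' z).snd.snd.fst i) μ
    rw [h.fderiv]; rfl
  have dh : ∀ z a, fderiv ℝ (fun y => (X y).2.2.2) z a = (fderiv ℝ X z a).2.2.2 := by
    intro z a
    rw [(hX' z).snd.snd.snd.fderiv]; rfl
  obtain ⟨f0, s0, b0, hq, hx⟩ := exists_potential n N (fun i μ y => (X y).2.2.1 i μ)
    (fun y => (X y).2.2.2)
    (fun i μ => contDiff_pi.1 (contDiff_pi.1 hX.snd.snd.fst i) μ) hX.snd.snd.snd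
    (fun z i j μ => by rw [dg, dg]; exact closed1 n N X H z i j μ)
    (fun z i => by simp only [dg, dh]; exact closed2 n N X H z i)
  refine ⟨f0, s0, b0, fun z v => ?_⟩
  have df0 : ∀ μ z, DifferentiableAt ℝ (fun y => f0 y μ) z := fun μ z =>
    (contDiff_pi.1 s0 μ).differentiable (by simp) z
  have hform : (fun (y : Pt n N) (u : Fin (n+1) → Pt n N) =>
            (∑ μ : Fin (n+2),
              ((∑ i : Fin N, y.2.2.1 i μ * (X y).2.1 i) + y.2.2.2 * (X y).1 μ + f0 y μ)
                * volm n N μ u)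
            + (1/2 : ℝ) * ∑ i : Fin N, ∑ μ : Fin (n+2), ∑ ν : Fin (n+2),
                (y.2.2.1 i ν * (X y).1 μ - y.2.2.1 i μ * (X y).1 ν)
                  * wedge1 n N (cq n N i) (volmn n N μ ν) u) =
      fun y u => theta n N y (Fin.cons (X y) u) + ∑ μ, f0 y μ * volm n N μ u := by
    funext y u
    rw [theta_cons]
    simp only [add_mul, Finset.sum_add_distrib]
    ring
  rw [hform, extd_eq]
  have hder : ∀ (u : Fin (n+1) → Pt n N) (a : Pt n N),
      fderiv ℝ (fun y => theta n N y (Fin.cons (X y) u) + ∑ μ, f0 y μ * volm n N μ u) z a =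
      theta n N a (Fin.cons (X z) u) + (theta n N z (Fin.cons (fderiv ℝ X z a) u) +
        ∑ μ, fderiv ℝ (fun y => f0 y μ) z a * volm n N μ u) := by
    intro u a
    obtain ⟨D, hD, hDa⟩ := fderiv_theta n N X z (hd z) u
    have h2 : HasFDerivAt (fun y => theta n N y (Fin.cons (X y) u) + ∑ μ, f0 y μ * volm n N μ u)
        _ z := hD.add (HasFDerivAt.fun_sum (u := Finset.univ) fun μ _ =>
          (df0 μ z).hasFDerivAt.mul_const (volm n N μ u))
    rw [h2.fderiv, ContinuousLinearMap.add_apply, hDa, ContinuousLinearMap.sum_apply, add_assoc]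
    simp [mul_comm]
  simp only [hder, asum_add]
  have hV : ∀ μ w, isV n N w → fderiv ℝ (fun y => f0 y μ) z w = 0 := by
    intro μ w hw
    have e : (fun y => f0 y μ) = fun y => f0 (Lt n N 1 y) μ := by
      funext y
      rw [b0 y (Lt n N 1 y) rfl (by simp [Lt_apply])]
    have h2 : HasFDerivAt (fun y => f0 (Lt n N 1 y) μ) _ z :=
      HasFDerivAt.comp z (df0 μ (Lt n N 1 z)).hasFDerivAt (Lt n N 1).hasFDerivAt
    rw [e, h2.fderiv, ContinuousLinearMap.comp_apply, (isV_iff n N w).1 hw, map_zero]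
  rw [final_alg n N (fun μ => fderiv ℝ (fun y => f0 y μ) z) hV (X (Lt n N 1 z))
    (fun μ i => hq z i μ) (hx z)]
  have h5 := affine n N X hX H hN z v
  rw [star' n N X H hN _ (isV_sub n N z)] at h5
  have h6 : ∀ u, theta n N (z - Lt n N 1 z) u = theta n N z u := by
    intro u
    have := theta_add n N (z - Lt n N 1 z) (Lt n N 1 z) u
    rw [sub_add_cancel, theta_base n N (Lt n N 1 z) rfl, add_zero] at this
    exact this.symm
  simp only [h6] at h5
  rw [iVF, omega_cons, h5]
  ring
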